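/- Let ρ, ν be two distinct stationary ergodic process distributions over a finite alphabet A, and let ε > 0. Then there is no uniformly consistent test for H_0 = {ρ} against H_1 = {ν' ∈ E : d(ν',ν) ≤ ε}, where E is the set of stationary ergodic process distributions and d is the distributional distance. -/

import Mathlib

open MeasureTheory Filter Topology

namespace Paper

variable {A : Type*} [Fintype A] [MeasurableSpace A]

/-- The left shift on one-sided infinite sequences. -/
def shift (x : ℕ → A) : ℕ → A := fun n => x (n + 1)

/-- A process distribution is stationary if it is invariant under the left shift. -/
def Stationary (ρ : Measure (ℕ → A)) : Prop := Measure.map shift ρ = ρ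

/-- The cylinder set of sequences starting with the word `B ∈ A^k`. -/
def wordCyl {k : ℕ} (B : Fin k → A) : Set (ℕ → A) := {x | ∀ i : Fin k, x i = B i}

open Classical in
/-- Empirical frequency `ν(X_{1..n}, B)` of the word `B ∈ A^k` in the first `n` symbols
of `x` (0 when `n < k`). -/
noncomputable def freqWord {k : ℕ} (B : Fin k → A) (n : ℕ) (x : ℕ → A) : ℝ :=
  if k ≤ n then
    (∑ i ∈ Finset.range (n - k + 1), if (∀ j : Fin k, x (i + j) = B j) then (1 : ℝ) else 0) /
      ((n : ℝ) - k + 1)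
  else 0

/-- Ergodicity: the empirical frequency of every finite word converges a.s. to a constant. -/
def ErgodicProc (ρ : Measure (ℕ → A)) : Prop :=
  ∀ (k : ℕ) (B : Fin k → A),
    ∃ c : ℝ, ∀ᵐ x ∂ρ, Tendsto (fun n => freqWord B n x) atTop (𝓝 c)

/-- A stationary ergodic process distribution. -/
def StatErg (ρ : Measure (ℕ → A)) : Prop :=
  IsProbabilityMeasure ρ ∧ Stationary ρ ∧ ErgodicProc ρ

/-- The set `E` of stationary ergodic process distributions over the alphabet `A`. -/
def ergSet (A : Type*) [Fintype A] [MeasurableSpace A] : Set (Measure (ℕ → A)) :=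
  {ρ | StatErg ρ}

/-- Weights `w_k = 1/(k(k+1))` (indexing from 0: `w_k = 1/((k+1)(k+2))`). -/
noncomputable def wt (k : ℕ) : ℝ := 1 / ((k + 1) * (k + 2))

/-- The distributional distance `d(ρ₁,ρ₂) = Σ_k w_k Σ_{B ∈ A^k} |ρ₁(B) − ρ₂(B)|`. -/
noncomputable def dd (ρ₁ ρ₂ : Measure (ℕ → A)) : ℝ :=
  ∑' k : ℕ, wt k * ∑ B : Fin (k + 1) → A,
    |(ρ₁ (wordCyl B)).toReal - (ρ₂ (wordCyl B)).toReal|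

/-- The empirical distributional distance `d̂(X_{1..n}, ρ)`. -/
noncomputable def hatd (n : ℕ) (x : ℕ → A) (ρ : Measure (ℕ → A)) : ℝ :=
  ∑' k : ℕ, wt k * ∑ B : Fin (k + 1) → A,
    |freqWord B n x - (ρ (wordCyl B)).toReal|

/-- The empirical distributional distance from a sample to a hypothesis (set of
process distributions): `d̂(X_{1..n}, H) = inf_{ρ ∈ H} d̂(X_{1..n}, ρ)`. -/
noncomputable def hatdSet (n : ℕ) (x : ℕ → A) (H : Set (Measure (ℕ → A))) : ℝ :=
  ⨅ ρ : H, hatd n x (ρ : Measure (ℕ → A))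

/-- Closure of a set of (stationary) process distributions in the topology of the
distributional distance, taken within the space `S` of stationary process distributions. -/
def closureD (H : Set (Measure (ℕ → A))) : Set (Measure (ℕ → A)) :=
  {ρ | IsProbabilityMeasure ρ ∧ Stationary ρ ∧ ∀ ε : ℝ, 0 < ε → ∃ μ ∈ H, dd ρ μ < ε}

/-- `W` is the ergodic decomposition of the stationary process distribution `ρ`:
a Borel probability measure on the space of process distributions concentrated on the
stationary ergodic ones, with `ρ(s) = ∫ μ(s) dW(μ)` for every measurable `s`. -/
def IsErgodicDecomp (ρ : Measure (ℕ → A)) (W : Measure (Measure (ℕ → A))) : Prop :=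
  IsProbabilityMeasure W ∧ W (ergSet A) = 1 ∧
    ∀ s : Set (ℕ → A), MeasurableSet s → ρ s = ∫⁻ μ, μ s ∂W

/-- A test depends, at sample size `n`, only on the first `n` symbols. -/
def FinHorizon (φ : ℕ → (ℕ → A) → Bool) : Prop :=
  ∀ n x y, (∀ i < n, x i = y i) → φ n x = φ n y

/-- Uniform consistency of a test (`false` = accept `H₀`, `true` = accept `H₁`):
for every `α > 0`, for all large enough sample sizes, both probabilities of error are
less than `α`. -/
def UnifConsistent (φ : ℕ → (ℕ → A) → Bool) (H₀ H₁ : Set (Measure (ℕ → A))) : Prop :=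
  ∀ α : ℝ, 0 < α → ∃ N : ℕ, ∀ n ≥ N,
    (∀ ρ ∈ H₀, ρ {x | φ n x = true} < ENNReal.ofReal α) ∧
    (∀ ρ ∈ H₁, ρ {x | φ n x = false} < ENNReal.ofReal α)

/-- Asymmetric (`α`-level) consistency of a family of tests `ψ α`: Type I error is always
at most `α`, and under every distribution in `H₁`, a.s. the test outputs `1` from some
sample size on. -/
def AsymConsistent (ψ : ℝ → ℕ → (ℕ → A) → Bool) (H₀ H₁ : Set (Measure (ℕ → A))) : Prop :=
  (∀ α : ℝ, α ∈ Set.Ioo (0 : ℝ) 1 → ∀ n : ℕ, ∀ ρ ∈ H₀,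
    ρ {x | ψ α n x = true} ≤ ENNReal.ofReal α) ∧
  (∀ α : ℝ, α ∈ Set.Ioo (0 : ℝ) 1 → ∀ ρ ∈ H₁,
    ∀ᵐ x ∂ρ, ∀ᶠ n in atTop, ψ α n x = true)

/-- The `j`-fold left shift. -/
def shiftN (j : ℕ) (x : ℕ → A) : ℕ → A := fun i => x (i + j)

omit [Fintype A] in
lemma measurable_shiftN (j : ℕ) : Measurable (shiftN j : (ℕ → A) → ℕ → A) :=
  measurable_pi_lambda _ fun i => measurable_pi_apply (i + j)

omit [Fintype A] in
lemma measurable_shift : Measurable (shift : (ℕ → A) → ℕ → A) :=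
  measurable_pi_lambda _ fun i => measurable_pi_apply (i + 1)

omit [Fintype A] in
lemma Stationary.map_shiftN {μ : Measure (ℕ → A)} (h : Stationary μ) (j : ℕ) :
    μ.map (shiftN j) = μ := by
  induction j with
  | zero => exact Measure.map_id
  | succ j ih =>
    have : (shiftN (j + 1) : (ℕ → A) → ℕ → A) = shift ∘ shiftN j := by
      funext x i; simp [shiftN, shift]; congr 1; omega
    rw [this, ← Measure.map_map measurable_shift (measurable_shiftN j), ih]
    exact h

/-- The letters whose singletons are measurable. -/
def singSet (A : Type*) [MeasurableSpace A] : Set A := {a | MeasurableSet {a}}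

lemma measurableSet_singSet : MeasurableSet (singSet A) := by
  have : singSet A = ⋃ a ∈ singSet A, {a} := by ext; simp
  rw [this]
  exact MeasurableSet.biUnion (Set.to_countable _) fun a ha => ha

/-- A measure on sequences concentrated on the letters with measurable singletons. -/
def SingConc (μ : Measure (ℕ → A)) : Prop := ∀ᵐ x ∂μ, ∀ i, x i ∈ singSet A

omit [Fintype A] in
lemma preimage_comp_eq {f : A → A} (hf : ∀ S : Set A, MeasurableSet S → f ⁻¹' S = S)
    {T : Set (ℕ → A)} (hT : MeasurableSet T) : (fun x : ℕ → A => f ∘ x) ⁻¹' T = T := by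
  let m : MeasurableSpace (ℕ → A) :=
    { MeasurableSet' := fun S => (fun x : ℕ → A => f ∘ x) ⁻¹' S = S
      measurableSet_empty := rfl
      measurableSet_compl := fun S hS => by rw [Set.preimage_compl, hS]
      measurableSet_iUnion := fun S hS => by
        rw [Set.preimage_iUnion]; exact Set.iUnion_congr hS }
  have hle : (MeasurableSpace.pi : MeasurableSpace (ℕ → A)) ≤ m := by
    refine iSup_le fun i => ?_
    rintro _ ⟨S, hS, rfl⟩
    change (fun x : ℕ → A => f ∘ x) ⁻¹' ((fun x : ℕ → A => x i) ⁻¹' S) = _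
    rw [← Set.preimage_comp]
    change (fun x : ℕ → A => x i) ⁻¹' (f ⁻¹' S) = _
    rw [hf S hS]
  exact hle T hT

omit [Fintype A] in
lemma ae_comp_of_ae {μ : Measure (ℕ → A)} {f : A → A}
    (hf : ∀ S : Set A, MeasurableSet S → f ⁻¹' S = S) {P : (ℕ → A) → Prop}
    (h : ∀ᵐ x ∂μ, P x) : ∀ᵐ x ∂μ, P (f ∘ x) := by
  obtain ⟨T, hsub, hT, h0⟩ := exists_measurable_superset_of_null (ae_iff.1 h)
  rw [ae_iff]
  refine measure_mono_null (fun x hx => ?_) h0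
  rw [← preimage_comp_eq hf hT]
  exact hsub hx

open Classical in
/-- The indicator that the word `B` occurs in `x` at position `i`. -/
noncomputable def occ {k : ℕ} (B : Fin k → A) (x : ℕ → A) (i : ℕ) : ℝ :=
  if ∀ j : Fin k, x (i + j) = B j then 1 else 0

omit [Fintype A] [MeasurableSpace A] in
lemma occ_nonneg {k : ℕ} (B : Fin k → A) (x : ℕ → A) (i : ℕ) : 0 ≤ occ B x i := by
  unfold occ; split_ifs <;> norm_num

omit [Fintype A] [MeasurableSpace A] in
lemma occ_le_one {k : ℕ} (B : Fin k → A) (x : ℕ → A) (i : ℕ) : occ B x i ≤ 1 := by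
  unfold occ; split_ifs <;> norm_num

omit [Fintype A] [MeasurableSpace A] in
lemma occ_shiftN {k : ℕ} (B : Fin k → A) (x : ℕ → A) (i j : ℕ) :
    occ B (shiftN j x) i = occ B x (i + j) := by
  unfold occ shiftN
  congr 1
  simp only [eq_iff_iff]
  refine forall_congr' fun t => ?_
  rw [show i + (t : ℕ) + j = i + j + t by omega]

/-- The Cesàro averages of a sequence. -/
noncomputable def avg (a : ℕ → ℝ) (n : ℕ) : ℝ := (∑ i ∈ Finset.range n, a i) / n

omit [Fintype A] [MeasurableSpace A] in
lemma freqWord_eq {k : ℕ} (B : Fin k → A) (n : ℕ) (x : ℕ → A) (h : k ≤ n) :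
    freqWord B n x = avg (occ B x) (n + 1 - k) := by
  unfold freqWord avg occ
  rw [if_pos h, show n + 1 - k = n - k + 1 by omega]
  push_cast [Nat.cast_sub h]
  rfl

omit [Fintype A] [MeasurableSpace A] in
lemma tendsto_freqWord {k : ℕ} {B : Fin k → A} {x : ℕ → A} {c : ℝ}
    (h : Tendsto (avg (occ B x)) atTop (𝓝 c)) :
    Tendsto (fun n => freqWord B n x) atTop (𝓝 c) := by
  have h1 : Tendsto (fun n : ℕ => n + 1 - k) atTop atTop :=
    (tendsto_sub_atTop_nat k).comp (tendsto_add_atTop_nat 1)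
  refine (h.comp h1).congr' ?_
  filter_upwards [eventually_ge_atTop k] with n hn
  exact (freqWord_eq B n x hn).symm

lemma measure_atom_eq_zero {ρ : Measure (ℕ → A)} (h : StatErg ρ) {a : A}
    (ha : a ∉ singSet A) : ρ {x | x 0 ∈ measurableAtom a} = 0 := by
  classical
  obtain ⟨hp, hs, he⟩ := h
  have hC : MeasurableSet (measurableAtom a) := MeasurableSet.measurableAtom_of_countable a
  obtain ⟨b, hbC, hba⟩ : ∃ b ∈ measurableAtom a, b ≠ a := by
    by_contra! hcon
    apply ha
    have : measurableAtom a = {a} := by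
      ext z
      constructor
      · exact hcon z
      · rintro rfl; exact mem_measurableAtom_self _
    change MeasurableSet {a}
    rwa [← this]
  let f : A → A → A := fun c z => if z ∈ measurableAtom a then c else z
  have hf : ∀ c ∈ measurableAtom a, ∀ S : Set A, MeasurableSet S → f c ⁻¹' S = S := by
    intro c hc S hS
    ext z
    by_cases hz : z ∈ measurableAtom a
    · have h1 : ∀ w ∈ measurableAtom a, w ∈ S ↔ a ∈ S := fun w hw =>
        ⟨fun hw' => by
          by_contra hna
          exact mem_of_mem_measurableAtom hw hS.compl hna hw',
          fun h' => mem_of_mem_measurableAtom hw hS h'⟩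
      simp only [f, Set.mem_preimage, if_pos hz]
      rw [h1 c hc, h1 z hz]
    · simp only [f, Set.mem_preimage, if_neg hz]
  let B : Fin 1 → A := fun _ => a
  obtain ⟨c, hc⟩ := he 1 B
  have hb := ae_comp_of_ae (hf b hbC) hc
  have ha' := ae_comp_of_ae (hf a (mem_measurableAtom_self a)) hc
  have hc0 : c = 0 := by
    obtain ⟨x, hx⟩ := hb.exists
    refine tendsto_nhds_unique hx (tendsto_freqWord ?_)
    have : avg (occ B (f b ∘ x)) = fun _ => 0 := by
      funext n
      have : ∀ i, occ B (f b ∘ x) i = 0 := by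
        intro i
        unfold occ
        rw [if_neg]
        intro hcon
        have := hcon 0
        simp only [f, B, Function.comp] at this
        split_ifs at this with h1
        · exact hba this
        · rw [this] at h1; exact h1 (mem_measurableAtom_self a)
      simp [avg, this]
    rw [this]
    exact tendsto_const_nhds
  subst hc0
  have hocc : ∀ x i, occ B (f a ∘ x) i =
      ((fun x : ℕ → A => x i) ⁻¹' measurableAtom a).indicator (fun _ => (1 : ℝ)) x := by
    intro x i
    unfold occ
    rw [Set.indicator_apply]
    congr 1
    simp only [eq_iff_iff, f, B, Function.comp, Set.mem_preimage]
    constructor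
    · intro h1
      have := h1 0
      simp only [Fin.val_zero, add_zero] at this
      by_contra h2
      rw [if_neg h2] at this
      rw [this] at h2
      exact h2 (mem_measurableAtom_self a)
    · intro h1 j
      have : (j : ℕ) = 0 := by omega
      rw [this, add_zero, if_pos h1]
  have hmeas : ∀ i, MeasurableSet ((fun x : ℕ → A => x i) ⁻¹' measurableAtom a) :=
    fun i => measurable_pi_apply i hC
  have hmeasind : ∀ i, Measurable (((fun x : ℕ → A => x i) ⁻¹' measurableAtom a).indicator
      (fun _ => (1 : ℝ))) := fun i => measurable_const.indicator (hmeas i)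
  have hreal : ∀ i, ρ.real ((fun x : ℕ → A => x i) ⁻¹' measurableAtom a) =
      ρ.real {x | x 0 ∈ measurableAtom a} := by
    intro i
    have h0 : MeasurableSet {x : ℕ → A | x 0 ∈ measurableAtom a} := hmeas 0
    conv_rhs => rw [← hs.map_shiftN i, map_measureReal_apply (measurable_shiftN i) h0]
    congr 1
    ext x
    simp [shiftN]
  have hlim := tendsto_integral_of_dominated_convergence (μ := ρ)
    (F := fun n x => freqWord B (n + 1) (f a ∘ x)) (f := fun _ => 0) (fun _ => (1 : ℝ))
    (by
      intro n
      refine Measurable.aestronglyMeasurable ?_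
      simp only [freqWord_eq B _ _ (Nat.le_add_left 1 n), avg, hocc]
      exact (Finset.measurable_fun_sum _ fun i _ => hmeasind i).div_const _)
    (integrable_const _)
    (by
      intro n
      refine Eventually.of_forall fun x => ?_
      rw [freqWord_eq B _ _ (Nat.le_add_left 1 n), avg, Real.norm_eq_abs, abs_of_nonneg
        (div_nonneg (Finset.sum_nonneg fun i _ => occ_nonneg _ _ _) (Nat.cast_nonneg _))]
      refine div_le_one_of_le₀ ?_ (Nat.cast_nonneg _)
      calc _ ≤ ∑ i ∈ Finset.range (n + 1 + 1 - 1), (1 : ℝ) :=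
            Finset.sum_le_sum fun i _ => occ_le_one _ _ _
        _ = _ := by simp)
    (by
      filter_upwards [ha'] with x hx
      exact hx.comp (tendsto_add_atTop_nat 1))
  have hint : ∀ n : ℕ, ∫ x, freqWord B (n + 1) (f a ∘ x) ∂ρ =
      ρ.real {x | x 0 ∈ measurableAtom a} := by
    intro n
    simp only [freqWord_eq B _ _ (Nat.le_add_left 1 n), avg, hocc]
    rw [integral_div, integral_finsetSum _
      fun i _ => (integrable_const (1 : ℝ)).indicator (hmeas i)]
    simp only [integral_indicator_const _ (hmeas _), hreal]
    simp
    field_simp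
  simp only [hint, integral_zero] at hlim
  have := tendsto_nhds_unique hlim tendsto_const_nhds
  rwa [eq_comm, measureReal_eq_zero_iff] at this

lemma StatErg.singConc {ρ : Measure (ℕ → A)} (h : StatErg ρ) : SingConc ρ := by
  refine ae_all_iff.2 fun i => ?_
  have h0 : ∀ᵐ x ∂ρ, x 0 ∈ singSet A := by
    rw [ae_iff]
    refine measure_mono_null (t := ⋃ a ∈ (singSet A)ᶜ, {x | x 0 ∈ measurableAtom a}) ?_ ?_
    · intro x hx
      simp only [Set.mem_iUnion]
      exact ⟨x 0, hx, mem_measurableAtom_self _⟩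
    · exact (measure_biUnion_null_iff (Set.to_countable _)).2
        fun a ha => measure_atom_eq_zero h ha
  have h1 : ∀ᵐ x ∂(ρ.map (shiftN i)), x 0 ∈ singSet A := by rwa [h.2.1.map_shiftN i]
  have := ae_of_ae_map (measurable_shiftN i).aemeasurable h1
  filter_upwards [this] with x hx
  simpa [shiftN] using hx

lemma sum_range_mul_residues (a : ℕ → ℝ) (M n : ℕ) :
    ∑ i ∈ Finset.range (n * M), a i =
      ∑ r ∈ Finset.range M, ∑ m ∈ Finset.range n, a (m * M + r) := by
  rw [Finset.sum_comm]
  induction n with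
  | zero => simp
  | succ n ih => rw [add_mul, one_mul, Finset.sum_range_add, ih, Finset.sum_range_succ]

lemma tendsto_avg_of_residues {a : ℕ → ℝ} (h0 : ∀ i, 0 ≤ a i) {M : ℕ} (hM : 0 < M)
    {c : ℕ → ℝ} (h : ∀ r, Tendsto (avg fun m => a (m * M + r)) atTop (𝓝 (c r))) :
    Tendsto (avg a) atTop (𝓝 ((∑ r ∈ Finset.range M, c r) / M)) := by
  have hM' : (0 : ℝ) < M := Nat.cast_pos.2 hM
  refine tendsto_div_of_monotone_of_exists_subseq_tendsto_div
    (fun n => ∑ i ∈ Finset.range n, a i) _ ?_ fun q hq => ⟨fun n => (n + 1) * M, ?_, ?_, ?_⟩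
  · intro m n hmn
    exact Finset.sum_le_sum_of_subset_of_nonneg
      (Finset.range_mono hmn) fun i _ _ => h0 i
  · obtain ⟨n0, hn0⟩ := exists_nat_gt (1 / (q - 1))
    filter_upwards [eventually_ge_atTop n0] with n hn
    have hq' : 0 < q - 1 := by linarith
    have h1 : 1 / (q - 1) < n := hn0.trans_le (by exact_mod_cast hn)
    rw [div_lt_iff₀ hq'] at h1
    push_cast
    rw [← mul_assoc]
    refine mul_le_mul_of_nonneg_right ?_ hM'.le
    nlinarith
  · exact tendsto_atTop_mono (fun n => by nlinarith) (tendsto_add_atTop_nat 1)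
  · have h1 := tendsto_finsetSum (Finset.range M) fun r _ =>
      (h r).comp (tendsto_add_atTop_nat 1)
    refine (h1.div_const (M : ℝ)).congr fun n => ?_
    simp only [Function.comp, avg]
    rw [sum_range_mul_residues, ← Finset.sum_div, div_div]
    push_cast
    rfl

lemma tendsto_avg_succ {a : ℕ → ℝ} {c : ℝ} (h : Tendsto (avg a) atTop (𝓝 c)) :
    Tendsto (avg fun i => a (i + 1)) atTop (𝓝 c) := by
  have h1 := h.comp (tendsto_add_atTop_nat 1)
  have h2 : Tendsto (fun n : ℕ => 1 + 1 / (n : ℝ)) atTop (𝓝 (1 + 0)) :=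
    tendsto_const_nhds.add tendsto_one_div_atTop_nhds_zero_nat
  have h3 : Tendsto (fun n : ℕ => a 0 / (n : ℝ)) atTop (𝓝 0) :=
    tendsto_const_div_atTop_nhds_zero_nat _
  have h4 := (h1.mul h2).sub h3
  rw [add_zero, mul_one, sub_zero] at h4
  refine h4.congr' ?_
  filter_upwards [eventually_gt_atTop 0] with n hn
  have hn' : (n : ℝ) ≠ 0 := by positivity
  have hn1 : (n : ℝ) + 1 ≠ 0 := by positivity
  simp only [Function.comp, avg]
  rw [Finset.sum_range_succ' a]
  push_cast
  field_simp
  ring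

lemma tendsto_avg_add {a : ℕ → ℝ} {c : ℝ} (h : Tendsto (avg a) atTop (𝓝 c)) (j : ℕ) :
    Tendsto (avg fun i => a (i + j)) atTop (𝓝 c) := by
  induction j with
  | zero => exact h
  | succ j ih =>
    have := tendsto_avg_succ ih
    refine this.congr fun n => ?_
    simp only [add_assoc, add_comm 1 j]

/-- Concatenation of the length-`L` initial blocks of a sequence of sequences. -/
def flatten (L : ℕ) (y : ℕ → ℕ → A) : ℕ → A := fun i => y (i / L) (i % L)

omit [Fintype A] in
lemma measurable_flatten (L : ℕ) : Measurable (flatten L : (ℕ → ℕ → A) → ℕ → A) :=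
  measurable_pi_lambda _ fun i => (measurable_pi_apply (i % L)).comp (measurable_pi_apply (i / L))

omit [Fintype A] [MeasurableSpace A] in
lemma flatten_comp_add (L : ℕ) (hL : 0 < L) (y : ℕ → ℕ → A) (m : ℕ) :
    flatten L (fun i => y (i + m)) = shiftN (L * m) (flatten L y) := by
  funext i
  simp [flatten, shiftN, Nat.add_mul_div_left _ _ hL]

/-- The law of an independent sequence of sequences, each distributed as `μ`. -/
noncomputable def iidLaw (μ : Measure (ℕ → A)) [IsProbabilityMeasure μ] :
    Measure (ℕ → ℕ → A) := Measure.infinitePi fun _ : ℕ => μ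

omit [Fintype A] in
lemma measurePreserving_iidLaw_add (μ : Measure (ℕ → A)) [IsProbabilityMeasure μ] (m : ℕ) :
    MeasurePreserving (fun (y : ℕ → ℕ → A) i => y (i + m)) (iidLaw μ) (iidLaw μ) :=
  ⟨measurable_pi_lambda _ fun i => measurable_pi_apply (i + m),
    Measure.map_infinitePi_infinitePi_of_inj (P := fun _ : ℕ => μ) (add_left_injective m)⟩

instance (μ : Measure (ℕ → A)) [IsProbabilityMeasure μ] : IsProbabilityMeasure (iidLaw μ) := by
  unfold iidLaw; infer_instance

omit [Fintype A] in
lemma measurableSet_coord_eq (i : ℕ) {a : A} (ha : a ∈ singSet A) :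
    MeasurableSet {x : ℕ → A | x i = a} := by
  have h : MeasurableSet ({a} : Set A) := ha
  exact (measurable_pi_apply (X := fun _ : ℕ => A) i) h

omit [Fintype A] in
lemma measurable_occ {k : ℕ} {B : Fin k → A} (hB : ∀ j, B j ∈ singSet A) (i : ℕ) :
    Measurable fun x : ℕ → A => occ B x i := by
  unfold occ
  refine Measurable.ite ?_ measurable_const measurable_const
  rw [Set.ofPred_forall]
  exact MeasurableSet.iInter fun j => measurableSet_coord_eq (i + (j : ℕ)) (hB j)

omit [Fintype A] in
lemma ae_tendsto_residue (μ : Measure (ℕ → A)) [IsProbabilityMeasure μ] {L : ℕ} (hL : 0 < L)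
    {k : ℕ} {B : Fin k → A} (hB : ∀ j, B j ∈ singSet A) (r : ℕ) :
    ∃ c : ℝ, ∀ᵐ y ∂(iidLaw μ), Tendsto
      (avg fun m => occ B (flatten L y) (m * (L * (k + 1)) + r)) atTop (𝓝 c) := by
  let X : ℕ → (ℕ → ℕ → A) → ℝ := fun m y => occ B (flatten L y) (m * (L * (k + 1)) + r)
  have hXm : ∀ m, Measurable (X m) := fun m =>
    (measurable_occ hB _).comp (measurable_flatten L)
  have hX0 : ∀ m y, X m y = X 0 (fun i => y (i + m * (k + 1))) := by
    intro m y
    simp only [X]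
    rw [flatten_comp_add L hL, occ_shiftN]
    congr 1
    ring
  have hint : Integrable (X 0) (iidLaw μ) :=
    Integrable.of_bound (hXm 0).aestronglyMeasurable 1 (Eventually.of_forall fun y => by
      rw [Real.norm_eq_abs, abs_of_nonneg (occ_nonneg _ _ _)]; exact occ_le_one _ _ _)
  have hident : ∀ m, ProbabilityTheory.IdentDistrib (X m) (X 0) (iidLaw μ) (iidLaw μ) := by
    intro m
    refine ⟨(hXm m).aemeasurable, (hXm 0).aemeasurable, ?_⟩
    have hmp := measurePreserving_iidLaw_add μ (m * (k + 1))
    rw [show X m = X 0 ∘ fun (y : ℕ → ℕ → A) i => y (i + m * (k + 1)) from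
      funext fun y => hX0 m y, ← Measure.map_map (hXm 0) hmp.measurable, hmp.map_eq]
  let S : ℕ → Set ℕ := fun m => {i | m * (k + 1) + r / L ≤ i ∧ i < (m + 1) * (k + 1) + r / L}
  have hS : ∀ m n, m < n → Disjoint (S m) (S n) := by
    intro m n hmn
    rw [Set.disjoint_left]
    rintro i ⟨_, h1⟩ ⟨h2, _⟩
    have : (m + 1) * (k + 1) ≤ n * (k + 1) := Nat.mul_le_mul_right _ hmn
    omega
  have hS' : ∀ m n, m ≠ n → Disjoint (S m) (S n) := by
    intro m n hmn
    rcases lt_or_gt_of_ne hmn with h | h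
    · exact hS m n h
    · exact (hS n m h).symm
  let ms : ℕ → MeasurableSpace (ℕ → ℕ → A) := fun i =>
    MeasurableSpace.comap (fun y => y i) inferInstance
  have hmeas : ∀ m, Measurable[⨆ i ∈ S m, ms i] (X m) := by
    intro m
    simp only [X, occ]
    refine Measurable.ite ?_ measurable_const measurable_const
    rw [Set.ofPred_forall]
    refine MeasurableSet.iInter fun j => ?_
    have hidx : (m * (L * (k + 1)) + r + j) / L ∈ S m := by
      have e : m * (L * (k + 1)) + r + j = (r + j) + L * (m * (k + 1)) := by ring
      rw [e, Nat.add_mul_div_left _ _ hL]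
      have h1 : r / L ≤ (r + j) / L := Nat.div_le_div_right (by omega)
      have h2 : (r + j) / L ≤ r / L + j := by
        calc (r + j) / L ≤ (r + L * j) / L :=
              Nat.div_le_div_right (by nlinarith [Nat.zero_le (j : ℕ)])
          _ = r / L + j := Nat.add_mul_div_left _ _ hL
      have h3 : (j : ℕ) < k := j.2
      refine ⟨by omega, ?_⟩
      rw [add_mul m]
      omega
    have hle : ms ((m * (L * (k + 1)) + r + j) / L) ≤ ⨆ i ∈ S m, ms i :=
      le_iSup₂_of_le _ hidx le_rfl
    refine hle _ ⟨{z | z ((m * (L * (k + 1)) + r + j) % L) = B j}, ?_, rfl⟩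
    exact measurableSet_coord_eq _ (hB j)
  have hiind : ProbabilityTheory.iIndep ms (iidLaw μ) :=
    (ProbabilityTheory.iIndepFun_iff_iIndep _ _ _).1
      (ProbabilityTheory.iIndepFun_infinitePi (P := fun _ : ℕ => μ) (X := fun _ z => z)
        fun _ => measurable_id)
  have hindep : Pairwise (Function.onFun
      (fun f g => ProbabilityTheory.IndepFun f g (iidLaw μ)) X) := by
    intro m n hmn
    rw [Function.onFun, ProbabilityTheory.IndepFun_iff_Indep]
    have := ProbabilityTheory.indep_iSup_of_disjoint
      (fun i => (measurable_pi_apply i).comap_le) hiind (hS' m n hmn)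
    exact ProbabilityTheory.indep_of_indep_of_le_left
      (ProbabilityTheory.indep_of_indep_of_le_right this (hmeas n).comap_le) (hmeas m).comap_le
  exact ⟨_, ProbabilityTheory.strong_law_ae_real X hint hindep hident⟩

omit [Fintype A] in
lemma ae_tendsto_flatten (μ : Measure (ℕ → A)) [IsProbabilityMeasure μ] {L : ℕ} (hL : 0 < L)
    {k : ℕ} {B : Fin k → A} (hB : ∀ j, B j ∈ singSet A) :
    ∃ c : ℝ, ∀ᵐ y ∂(iidLaw μ), Tendsto (avg (occ B (flatten L y))) atTop (𝓝 c) := by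
  choose c hc using ae_tendsto_residue μ hL hB
  refine ⟨(∑ r ∈ Finset.range (L * (k + 1)), c r) / ((L * (k + 1) : ℕ) : ℝ), ?_⟩
  filter_upwards [ae_all_iff.2 hc] with y hy
  exact tendsto_avg_of_residues (occ_nonneg _ _) (Nat.mul_pos hL k.succ_pos) hy

/-- The stationary process that concatenates independent length-`L` blocks of `μ`, observed
from a uniformly random phase. -/
noncomputable def blockProc (μ : Measure (ℕ → A)) [IsProbabilityMeasure μ] (L : ℕ) :
    Measure (ℕ → A) :=
  (L : ENNReal)⁻¹ • ∑ j ∈ Finset.range L, (iidLaw μ).map (fun y => shiftN j (flatten L y))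

omit [Fintype A] in
lemma measurable_shiftN_flatten (L j : ℕ) :
    Measurable (fun y : ℕ → ℕ → A => shiftN j (flatten L y)) :=
  (measurable_shiftN j).comp (measurable_flatten L)

omit [Fintype A] in
lemma blockProc_apply (μ : Measure (ℕ → A)) [IsProbabilityMeasure μ] (L : ℕ)
    {E : Set (ℕ → A)} (hE : MeasurableSet E) :
    blockProc μ L E = (L : ENNReal)⁻¹ *
      ∑ j ∈ Finset.range L, iidLaw μ {y | shiftN j (flatten L y) ∈ E} := by
  simp only [blockProc, Measure.smul_apply, Measure.finsetSum_apply, smul_eq_mul]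
  congr 1
  exact Finset.sum_congr rfl fun j _ => Measure.map_apply (measurable_shiftN_flatten L j) hE

omit [Fintype A] in
lemma isProbabilityMeasure_blockProc (μ : Measure (ℕ → A)) [IsProbabilityMeasure μ] {L : ℕ}
    (hL : 0 < L) : IsProbabilityMeasure (blockProc μ L) := by
  constructor
  rw [blockProc_apply μ L MeasurableSet.univ]
  simp
  exact ENNReal.inv_mul_cancel (by exact_mod_cast hL.ne') (ENNReal.natCast_ne_top L)

omit [Fintype A] in
lemma stationary_blockProc (μ : Measure (ℕ → A)) [IsProbabilityMeasure μ] {L : ℕ}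
    (hL : 0 < L) : Stationary (blockProc μ L) := by
  unfold Stationary
  ext E hE
  rw [Measure.map_apply measurable_shift hE, blockProc_apply μ L hE,
    blockProc_apply μ L (measurable_shift hE)]
  congr 1
  let g : ℕ → ENNReal := fun j => iidLaw μ {y | shiftN j (flatten L y) ∈ E}
  have h1 : ∀ j, iidLaw μ {y | shiftN j (flatten L y) ∈ shift ⁻¹' E} = g (j + 1) := by
    intro j
    have : ∀ y : ℕ → ℕ → A, shift (shiftN j (flatten L y)) = shiftN (j + 1) (flatten L y) := by
      intro y; funext i; simp only [shift, shiftN]; congr 1; omega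
    simp only [Set.mem_preimage, this, g]
  have h2 : g L = g 0 := by
    have hm : MeasurableSet {y : ℕ → ℕ → A | shiftN 0 (flatten L y) ∈ E} :=
      measurable_shiftN_flatten L 0 hE
    have := (measurePreserving_iidLaw_add μ 1).measure_preimage hm.nullMeasurableSet
    simp only [g]
    rw [← this]
    congr 1
    ext y
    simp only [Set.mem_ofPred_eq, Set.mem_preimage, flatten_comp_add L hL, mul_one]
    rfl
  simp only [h1]
  change ∑ j ∈ Finset.range L, g (j + 1) = ∑ j ∈ Finset.range L, g j
  obtain ⟨n, rfl⟩ : ∃ n, L = n + 1 := ⟨L - 1, by omega⟩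
  rw [Finset.sum_range_succ, h2, Finset.sum_range_succ' g]

omit [Fintype A] in
lemma ae_blockProc (μ : Measure (ℕ → A)) [IsProbabilityMeasure μ] (L : ℕ)
    {p : (ℕ → A) → Prop} (hp : MeasurableSet {x | p x})
    (h : ∀ᵐ y ∂(iidLaw μ), ∀ j, p (shiftN j (flatten L y))) : ∀ᵐ x ∂(blockProc μ L), p x := by
  have hc : MeasurableSet {x | ¬ p x} := hp.compl
  rw [ae_iff, blockProc_apply μ L hc]
  simp only [mul_eq_zero, Finset.sum_eq_zero_iff]
  right
  intro j _
  exact ae_iff.1 (ae_all_iff.1 h j)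

omit [Fintype A] in
lemma ae_iidLaw (μ : Measure (ℕ → A)) [IsProbabilityMeasure μ] (m : ℕ) {p : (ℕ → A) → Prop}
    (h : ∀ᵐ x ∂μ, p x) : ∀ᵐ y ∂(iidLaw μ), p (y m) :=
  (measurePreserving_eval_infinitePi (fun _ : ℕ => μ) m).quasiMeasurePreserving.ae h

lemma singConc_blockProc {μ : Measure (ℕ → A)} [IsProbabilityMeasure μ] (h : SingConc μ)
    (L : ℕ) : SingConc (blockProc μ L) := by
  refine ae_blockProc μ L ?_ ?_
  · rw [Set.ofPred_forall]
    exact MeasurableSet.iInter fun i => measurable_pi_apply i measurableSet_singSet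
  · filter_upwards [ae_all_iff.2 fun m => ae_iidLaw μ m h] with y hy j i
    exact hy _ _

lemma ergodicProc_blockProc {μ : Measure (ℕ → A)} [IsProbabilityMeasure μ] (h : SingConc μ)
    {L : ℕ} (hL : 0 < L) : ErgodicProc (blockProc μ L) := by
  intro k B
  by_cases hB : ∀ j, B j ∈ singSet A
  · obtain ⟨c, hc⟩ := ae_tendsto_flatten μ hL hB
    refine ⟨c, ?_⟩
    have : ∀ᵐ x ∂(blockProc μ L), Tendsto (fun n => avg (occ B x) n) atTop (𝓝 c) := by
      refine ae_blockProc μ L ?_ ?_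
      · refine measurableSet_tendsto (𝓝 c) fun n => ?_
        exact (Finset.measurable_fun_sum _ fun i _ => measurable_occ hB i).div_const _
      · filter_upwards [hc] with y hy j
        simp only [occ_shiftN, avg]
        exact tendsto_avg_add hy j
    filter_upwards [this] with x hx
    exact tendsto_freqWord hx
  · push Not at hB
    obtain ⟨j, hj⟩ := hB
    refine ⟨0, ?_⟩
    filter_upwards [singConc_blockProc h L] with x hx
    refine tendsto_freqWord ?_
    have h0 : ∀ i, occ B x i = 0 := by
      intro i
      unfold occ
      rw [if_neg]
      intro hcon
      exact hj (hcon j ▸ hx _)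
    have : avg (occ B x) = fun _ => 0 := by
      funext n; simp [avg, h0]
    rw [this]
    exact tendsto_const_nhds

lemma statErg_blockProc {μ : Measure (ℕ → A)} [IsProbabilityMeasure μ] (h : SingConc μ)
    {L : ℕ} (hL : 0 < L) : StatErg (blockProc μ L) :=
  ⟨isProbabilityMeasure_blockProc μ hL, stationary_blockProc μ hL, ergodicProc_blockProc h hL⟩

omit [Fintype A] in
lemma le_blockProc_real {μ : Measure (ℕ → A)} [IsProbabilityMeasure μ] (hs : Stationary μ)
    {L : ℕ} (hL : 0 < L) {n : ℕ} {E : Set (ℕ → A)} (hE : MeasurableSet E)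
    (hdep : ∀ x y : ℕ → A, (∀ i < n, x i = y i) → (x ∈ E ↔ y ∈ E)) :
    (1 - (n : ℝ) / L) * μ.real E ≤ (blockProc μ L).real E := by
  have hL' : (0 : ℝ) < L := Nat.cast_pos.2 hL
  rcases le_or_gt n L with hn | hn
  · have hterm : ∀ j ∈ Finset.range (L - n),
        (iidLaw μ).real {y | shiftN j (flatten L y) ∈ E} = μ.real E := by
      intro j hj
      have hj' : j + n ≤ L := by have := Finset.mem_range.1 hj; omega
      have hset : {y : ℕ → ℕ → A | shiftN j (flatten L y) ∈ E} =
          (fun y : ℕ → ℕ → A => y 0) ⁻¹' (shiftN j ⁻¹' E) := by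
        ext y
        refine hdep _ _ fun i hi => ?_
        have : i + j < L := by omega
        simp [shiftN, flatten, Nat.div_eq_of_lt this, Nat.mod_eq_of_lt this]
      have h1 : iidLaw μ ((fun y : ℕ → ℕ → A => y 0) ⁻¹' (shiftN j ⁻¹' E)) =
          μ (shiftN j ⁻¹' E) :=
        (measurePreserving_eval_infinitePi (fun _ : ℕ => μ) 0).measure_preimage
          (measurable_shiftN j hE).nullMeasurableSet
      rw [hset, measureReal_def, h1, ← Measure.map_apply (measurable_shiftN j) hE,
        hs.map_shiftN, measureReal_def]
    have hsum : ((L : ℝ) - n) * μ.real E ≤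
        ∑ j ∈ Finset.range L, (iidLaw μ).real {y | shiftN j (flatten L y) ∈ E} := by
      calc ((L : ℝ) - n) * μ.real E = ∑ j ∈ Finset.range (L - n),
            (iidLaw μ).real {y | shiftN j (flatten L y) ∈ E} := by
            rw [Finset.sum_congr rfl hterm]
            simp [Nat.cast_sub hn]
        _ ≤ _ := Finset.sum_le_sum_of_subset_of_nonneg
            (Finset.range_mono (Nat.sub_le L n)) fun _ _ _ => measureReal_nonneg
    have hval : (blockProc μ L).real E = (L : ℝ)⁻¹ *
        ∑ j ∈ Finset.range L, (iidLaw μ).real {y | shiftN j (flatten L y) ∈ E} := by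
      rw [measureReal_def, blockProc_apply μ L hE, ENNReal.toReal_mul, ENNReal.toReal_inv,
        ENNReal.toReal_natCast, ENNReal.toReal_sum fun _ _ => measure_ne_top _ _]
      rfl
    rw [hval]
    calc (1 - (n : ℝ) / L) * μ.real E = (L : ℝ)⁻¹ * (((L : ℝ) - n) * μ.real E) := by
          field_simp
      _ ≤ _ := mul_le_mul_of_nonneg_left hsum (inv_nonneg.2 hL'.le)
  · have : (1 - (n : ℝ) / L) ≤ 0 := by
      rw [sub_nonpos, one_le_div hL']
      exact_mod_cast hn.le
    exact (mul_nonpos_of_nonpos_of_nonneg this measureReal_nonneg).trans measureReal_nonneg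

omit [Fintype A] in
lemma measurableSet_wordCyl {k : ℕ} {B : Fin k → A} (hB : ∀ j, B j ∈ singSet A) :
    MeasurableSet (wordCyl B) := by
  rw [wordCyl, Set.ofPred_forall]
  exact MeasurableSet.iInter fun j => measurableSet_coord_eq (j : ℕ) (hB j)

omit [Fintype A] in
lemma SingConc.measure_wordCyl_eq_zero {μ : Measure (ℕ → A)} (h : SingConc μ) {k : ℕ}
    {B : Fin k → A} (hB : ¬ ∀ j, B j ∈ singSet A) : μ (wordCyl B) = 0 := by
  push Not at hB
  obtain ⟨j, hj⟩ := hB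
  have h0 : ∀ᵐ x ∂μ, ∀ i, x i ∈ singSet A := h
  rw [ae_iff] at h0
  refine measure_mono_null (fun x hx => ?_) h0
  intro hcon
  refine hj ?_
  rw [← hx j]
  exact hcon _

lemma SingConc.sum_wordCyl {μ : Measure (ℕ → A)} [IsProbabilityMeasure μ] (h : SingConc μ)
    (k : ℕ) : ∑ B : Fin k → A, μ.real (wordCyl B) = 1 := by
  have hnull : ∀ B : Fin k → A, NullMeasurableSet (wordCyl B) μ := by
    intro B
    by_cases hB : ∀ j, B j ∈ singSet A
    · exact (measurableSet_wordCyl hB).nullMeasurableSet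
    · exact NullMeasurableSet.of_null (h.measure_wordCyl_eq_zero hB)
  have hdisj : Pairwise (Function.onFun (AEDisjoint μ) fun B : Fin k → A => wordCyl B) := by
    intro B C hBC
    refine Disjoint.aedisjoint (Set.disjoint_left.2 fun x hx hx' => hBC ?_)
    funext j
    rw [← hx j, hx' j]
  have hU : (⋃ B : Fin k → A, wordCyl B) = Set.univ :=
    Set.eq_univ_of_forall fun x => Set.mem_iUnion.2 ⟨fun j => x j, fun _ => rfl⟩
  have := measure_iUnion₀ hdisj hnull
  rw [hU, measure_univ, tsum_fintype] at this
  simp only [measureReal_def]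
  rw [← ENNReal.toReal_sum fun _ _ => measure_ne_top _ _, ← this, ENNReal.toReal_one]

/-- The total variation of two measures on words of length `k`. -/
noncomputable def wordDist (p q : Measure (ℕ → A)) (k : ℕ) : ℝ :=
  ∑ B : Fin k → A, |(p (wordCyl B)).toReal - (q (wordCyl B)).toReal|

lemma wordDist_le_two {p q : Measure (ℕ → A)} [IsProbabilityMeasure p] [IsProbabilityMeasure q]
    (hp : SingConc p) (hq : SingConc q) (k : ℕ) : wordDist p q k ≤ 2 := by
  calc wordDist p q k ≤ ∑ B : Fin k → A, (p.real (wordCyl B) + q.real (wordCyl B)) := by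
        refine Finset.sum_le_sum fun B _ => ?_
        have h1 : 0 ≤ (p (wordCyl B)).toReal := ENNReal.toReal_nonneg
        have h2 : 0 ≤ (q (wordCyl B)).toReal := ENNReal.toReal_nonneg
        rw [measureReal_def, measureReal_def, abs_le]
        constructor <;> linarith
    _ = 2 := by rw [Finset.sum_add_distrib, hp.sum_wordCyl, hq.sum_wordCyl]; norm_num

lemma wordDist_le {p q : Measure (ℕ → A)} [IsProbabilityMeasure p] [IsProbabilityMeasure q]
    (hp : SingConc p) (hq : SingConc q) (k : ℕ) {η : ℝ} (hη : 0 ≤ η)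
    (h : ∀ B : Fin k → A, (1 - η) * q.real (wordCyl B) ≤ p.real (wordCyl B)) :
    wordDist p q k ≤ 2 * η := by
  calc wordDist p q k ≤ ∑ B : Fin k → A,
        (p.real (wordCyl B) - q.real (wordCyl B) + 2 * η * q.real (wordCyl B)) := by
        refine Finset.sum_le_sum fun B _ => ?_
        have h2 : 0 ≤ η * q.real (wordCyl B) := mul_nonneg hη measureReal_nonneg
        have h3 := h B
        rw [← measureReal_def, ← measureReal_def, abs_le]
        constructor <;> linarith
    _ = 2 * η := by
        rw [Finset.sum_add_distrib, Finset.sum_sub_distrib, ← Finset.mul_sum,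
          hp.sum_wordCyl, hq.sum_wordCyl]
        ring

lemma wt_nonneg (k : ℕ) : 0 ≤ wt k := by unfold wt; positivity

lemma summable_wt : Summable wt := by
  have h := (summable_nat_add_iff 1).2 (Real.summable_one_div_nat_pow.2 (one_lt_two))
  refine Summable.of_nonneg_of_le wt_nonneg (fun k => ?_) h
  unfold wt
  refine one_div_le_one_div_of_le (by positivity) ?_
  push_cast
  nlinarith [(Nat.cast_nonneg k : (0 : ℝ) ≤ k)]

lemma tendsto_tail_bound :
    Tendsto (fun L : ℕ => ∑' k : ℕ, wt k * min 2 (2 * (((k + 1 : ℕ) : ℝ) / L))) atTop (𝓝 0) := by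
  have h := tendsto_tsum_of_dominated_convergence (𝓕 := atTop)
    (f := fun (L : ℕ) (k : ℕ) => wt k * min 2 (2 * (((k + 1 : ℕ) : ℝ) / L)))
    (g := fun _ => (0 : ℝ)) (bound := fun k => wt k * 2) (summable_wt.mul_right 2)
    (by
      intro k
      have h1 : Tendsto (fun L : ℕ => 2 * (((k + 1 : ℕ) : ℝ) / L)) atTop (𝓝 (2 * 0)) :=
        (tendsto_const_div_atTop_nhds_zero_nat _).const_mul 2
      have h2 := ((tendsto_const_nhds (x := (2 : ℝ))).min h1).const_mul (wt k)
      simpa using h2)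
    (Eventually.of_forall fun L k => by
      have : 0 ≤ min 2 (2 * (((k + 1 : ℕ) : ℝ) / L)) := le_min (by norm_num) (by positivity)
      rw [Real.norm_eq_abs, abs_of_nonneg (mul_nonneg (wt_nonneg k) this)]
      exact mul_le_mul_of_nonneg_left (min_le_left _ _) (wt_nonneg k))
  simpa using h

lemma dd_le {p q : Measure (ℕ → A)} [IsProbabilityMeasure p] [IsProbabilityMeasure q]
    (hp : SingConc p) (hq : SingConc q) {δ : ℝ} (hδ : 0 ≤ δ) {L : ℕ}
    (h : ∀ (k : ℕ) (B : Fin k → A),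
      (1 - (δ + (k : ℝ) / L)) * q.real (wordCyl B) ≤ p.real (wordCyl B)) :
    dd p q ≤ 2 * δ * ∑' k, wt k + ∑' k : ℕ, wt k * min 2 (2 * (((k + 1 : ℕ) : ℝ) / L)) := by
  have hs : Summable fun k : ℕ => wt k * min 2 (2 * (((k + 1 : ℕ) : ℝ) / L)) :=
    Summable.of_nonneg_of_le
      (fun k => mul_nonneg (wt_nonneg k) (le_min (by norm_num) (by positivity)))
      (fun k => mul_le_mul_of_nonneg_left (min_le_left _ _) (wt_nonneg k))
      (summable_wt.mul_right 2)
  rw [← tsum_mul_left, ← (summable_wt.mul_left (2 * δ)).tsum_add hs]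
  have hle : ∀ k : ℕ, wt k * wordDist p q (k + 1) ≤
      2 * δ * wt k + wt k * min 2 (2 * (((k + 1 : ℕ) : ℝ) / L)) := by
    intro k
    have h1 := wordDist_le_two hp hq (k + 1)
    have h2 := wordDist_le hp hq (k + 1) (η := δ + ((k + 1 : ℕ) : ℝ) / L) (by positivity)
      (h (k + 1))
    have h3 : wordDist p q (k + 1) ≤ 2 * δ + min 2 (2 * (((k + 1 : ℕ) : ℝ) / L)) := by
      rw [← min_add_add_left]
      exact le_min (by linarith) (by linarith)
    nlinarith [mul_le_mul_of_nonneg_left h3 (wt_nonneg k)]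
  refine Summable.tsum_le_tsum hle ?_ ((summable_wt.mul_left (2 * δ)).add hs)
  refine Summable.of_nonneg_of_le (fun k => mul_nonneg (wt_nonneg k) ?_)
    (fun k => mul_le_mul_of_nonneg_left (wordDist_le_two hp hq (k + 1)) (wt_nonneg k))
    (summable_wt.mul_right 2)
  exact Finset.sum_nonneg fun B _ => abs_nonneg _

/-- The mixture `(1 - δ) ν + δ ρ`. -/
noncomputable def mix (δ : ℝ) (ρ ν : Measure (ℕ → A)) : Measure (ℕ → A) :=
  ENNReal.ofReal (1 - δ) • ν + ENNReal.ofReal δ • ρ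

omit [Fintype A] in
lemma mix_real {δ : ℝ} (h0 : 0 ≤ δ) (h1 : δ ≤ 1) (ρ ν : Measure (ℕ → A))
    [IsFiniteMeasure ρ] [IsFiniteMeasure ν] (E : Set (ℕ → A)) :
    (mix δ ρ ν).real E = (1 - δ) * ν.real E + δ * ρ.real E := by
  simp only [measureReal_def, mix, Measure.add_apply, Measure.smul_apply, smul_eq_mul]
  rw [ENNReal.toReal_add (ENNReal.mul_ne_top ENNReal.ofReal_ne_top (measure_ne_top _ _))
    (ENNReal.mul_ne_top ENNReal.ofReal_ne_top (measure_ne_top _ _)), ENNReal.toReal_mul,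
    ENNReal.toReal_mul, ENNReal.toReal_ofReal h0, ENNReal.toReal_ofReal (by linarith)]

omit [Fintype A] in
lemma isProbabilityMeasure_mix {δ : ℝ} (h0 : 0 ≤ δ) (h1 : δ ≤ 1) (ρ ν : Measure (ℕ → A))
    [IsProbabilityMeasure ρ] [IsProbabilityMeasure ν] : IsProbabilityMeasure (mix δ ρ ν) := by
  constructor
  simp only [mix, Measure.add_apply, Measure.smul_apply, smul_eq_mul, measure_univ, mul_one]
  rw [← ENNReal.ofReal_add (by linarith) h0]
  simp

omit [Fintype A] in
lemma stationary_mix {ρ ν : Measure (ℕ → A)} (hρ : Stationary ρ) (hν : Stationary ν) (δ : ℝ) :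
    Stationary (mix δ ρ ν) := by
  unfold Stationary mix at *
  rw [Measure.map_add _ _ measurable_shift, Measure.map_smul, Measure.map_smul, hρ, hν]

omit [Fintype A] in
lemma singConc_mix {ρ ν : Measure (ℕ → A)} (hρ : SingConc ρ) (hν : SingConc ν) (δ : ℝ) :
    SingConc (mix δ ρ ν) :=
  ae_add_measure_iff.2 ⟨Measure.ae_smul_measure hν _, Measure.ae_smul_measure hρ _⟩

/-- The block process of a mixture `(1 - δ) ν + δ ρ` is close to `ν` when `δ` is small and the
blocks are long. -/
lemma dd_blockProc_mix_le {ρ ν : Measure (ℕ → A)} [IsProbabilityMeasure ρ]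
    [IsProbabilityMeasure ν] (hρ : Stationary ρ) (hν : Stationary ν) (cρ : SingConc ρ)
    (cν : SingConc ν) {δ : ℝ} (h0 : 0 ≤ δ) (h1 : δ ≤ 1) [IsProbabilityMeasure (mix δ ρ ν)]
    {L : ℕ} (hL : 0 < L) :
    dd (blockProc (mix δ ρ ν) L) ν ≤
      2 * δ * ∑' k, wt k + ∑' k : ℕ, wt k * min 2 (2 * (((k + 1 : ℕ) : ℝ) / L)) := by
  have cμ := singConc_mix cρ cν δ
  have := isProbabilityMeasure_blockProc (mix δ ρ ν) hL
  refine dd_le (singConc_blockProc cμ L) cν h0 fun k B => ?_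
  by_cases hB : ∀ j, B j ∈ singSet A
  · have hlow := le_blockProc_real (stationary_mix hρ hν δ) hL (n := k)
      (measurableSet_wordCyl hB) (fun x y hxy =>
        forall_congr' fun i => by rw [hxy i i.2])
    rw [mix_real h0 h1] at hlow
    have hν0 : 0 ≤ ν.real (wordCyl B) := measureReal_nonneg
    have hρ0 : 0 ≤ ρ.real (wordCyl B) := measureReal_nonneg
    have hk : 0 ≤ (k : ℝ) / L := by positivity
    rcases le_or_gt ((k : ℝ) / L) 1 with hk1 | hk1
    · have ha : 0 ≤ (1 - (k : ℝ) / L) * (δ * ρ.real (wordCyl B)) :=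
        mul_nonneg (by linarith) (mul_nonneg h0 hρ0)
      have hb : 0 ≤ δ * ((k : ℝ) / L) * ν.real (wordCyl B) :=
        mul_nonneg (mul_nonneg h0 hk) hν0
      linarith
    · exact (mul_nonpos_of_nonpos_of_nonneg (by linarith) hν0).trans measureReal_nonneg
  · rw [measureReal_def, cν.measure_wordCyl_eq_zero hB]
    simp

/-- For distinct stationary ergodic `ρ ≠ ν` and any `ε > 0`, there is no
uniformly consistent test for `H₀ = {ρ}` against `H₁ = {ν' ∈ E : d(ν',ν) ≤ ε}`. -/
theorem no_uniform_identity_test (ρ ν : Measure (ℕ → A))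
    (hρ : StatErg ρ) (hν : StatErg ν) (hne : ρ ≠ ν) (ε : ℝ) (hε : 0 < ε) :
    ¬ ∃ φ : ℕ → (ℕ → A) → Bool,
        (∀ n, Measurable (φ n)) ∧ FinHorizon φ ∧
        UnifConsistent φ {ρ} {ν' | StatErg ν' ∧ dd ν' ν ≤ ε} := by
  rintro ⟨φ, hφm, hφf, hcons⟩
  have cρ := hρ.singConc
  have cν := hν.singConc
  obtain ⟨pρ, sρ, -⟩ := hρ
  obtain ⟨pν, sν, -⟩ := hν
  set W : ℝ := ∑' k, wt k with hW
  have hW0 : 0 ≤ W := tsum_nonneg wt_nonneg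
  obtain ⟨δ, hδ0, hδ1, hδε⟩ : ∃ δ : ℝ, 0 < δ ∧ δ ≤ 1 / 2 ∧ 2 * δ * W ≤ ε / 2 := by
    refine ⟨min (1 / 2) (ε / (4 * (W + 1))), by positivity, min_le_left _ _, ?_⟩
    have h1 : min (1 / 2) (ε / (4 * (W + 1))) * (4 * (W + 1)) ≤ ε := by
      rw [← le_div_iff₀ (by positivity)]
      exact min_le_right _ _
    have h2 : 0 ≤ min (1 / 2) (ε / (4 * (W + 1))) := by positivity
    linarith
  have := isProbabilityMeasure_mix hδ0.le (by linarith : δ ≤ 1) ρ ν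
  obtain ⟨n, hn⟩ := hcons (δ / 4) (by linarith)
  obtain ⟨hn0, hn1⟩ := hn n le_rfl
  have hLn : ∀ᶠ L : ℕ in atTop, (n : ℝ) / L < 1 / 4 :=
    (tendsto_const_div_atTop_nhds_zero_nat (n : ℝ)).eventually_lt_const (by norm_num)
  have hLd := tendsto_tail_bound.eventually_lt_const (half_pos hε)
  obtain ⟨L, hL0, hLn, hLd⟩ := ((eventually_gt_atTop 0).and (hLn.and hLd)).exists
  have hdd := dd_blockProc_mix_le sρ sν cρ cν hδ0.le (by linarith : δ ≤ 1) hL0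
  have hmem : blockProc (mix δ ρ ν) L ∈ {ν' | StatErg ν' ∧ dd ν' ν ≤ ε} :=
    ⟨statErg_blockProc (singConc_mix cρ cν δ) hL0, by rw [← hW] at hdd; linarith⟩
  have hE : MeasurableSet {x | φ n x = false} := hφm n (measurableSet_singleton false)
  have herr0 : ρ.real {x | φ n x = true} < δ / 4 :=
    (ENNReal.lt_ofReal_iff_toReal_lt (measure_ne_top _ _)).1 (hn0 ρ rfl)
  have := isProbabilityMeasure_blockProc (mix δ ρ ν) hL0
  have herr1 : (blockProc (mix δ ρ ν) L).real {x | φ n x = false} < δ / 4 :=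
    (ENNReal.lt_ofReal_iff_toReal_lt (measure_ne_top _ _)).1 (hn1 _ hmem)
  have hcompl : ρ.real {x | φ n x = false} = 1 - ρ.real {x | φ n x = true} := by
    have : {x | φ n x = true} = {x | φ n x = false}ᶜ := by ext x; simp
    rw [this, probReal_compl_eq_one_sub hE]
    ring
  have hlow := le_blockProc_real (stationary_mix sρ sν δ) hL0 (n := n) hE
    (fun x y hxy => by simp only [Set.mem_ofPred_eq, hφf n x y hxy])
  rw [mix_real hδ0.le (by linarith)] at hlow
  have h1 : δ * (7 / 8) ≤
      (1 - δ) * ν.real {x | φ n x = false} + δ * ρ.real {x | φ n x = false} := by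
    have : 0 ≤ (1 - δ) * ν.real {x | φ n x = false} :=
      mul_nonneg (by linarith) measureReal_nonneg
    have : δ * (7 / 8) ≤ δ * ρ.real {x | φ n x = false} :=
      mul_le_mul_of_nonneg_left (by linarith) hδ0.le
    linarith
  have h2 : (3 / 4) * (δ * (7 / 8)) ≤ (1 - (n : ℝ) / L) *
      ((1 - δ) * ν.real {x | φ n x = false} + δ * ρ.real {x | φ n x = false}) :=
    mul_le_mul (by linarith) h1 (by positivity) (by linarith)
  linarith

end Paper
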